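/- For every preference profile P, the division A^{F*}(P) maximizes social welfare; consequently, the moving phantom mechanism A^{F*} is Pareto-optimal. -/

import Mathlib

open Finset

/-- `p` is a budget division over `m` alternatives: entries in `[0,1]` summing to `1`. -/
def IsDivision {m : ℕ} (p : Fin m → ℝ) : Prop :=
  (∀ j, p j ∈ Set.Icc (0 : ℝ) 1) ∧ ∑ j, p j = 1

/-- A valid preference profile: every voter reports a budget division. -/
def IsProfile {n m : ℕ} (P : Fin n → Fin m → ℝ) : Prop :=
  ∀ i, IsDivision (P i)

/-- The ℓ1 distance between two vectors. -/
noncomputable def l1 {m : ℕ} (x y : Fin m → ℝ) : ℝ := ∑ j, |x j - y j|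

/-- Median of a list of odd length `2k+1`: its `(k+1)`-st smallest element. -/
noncomputable def medList (l : List ℝ) : ℝ :=
  ((Multiset.ofList l).sort (· ≤ ·)).getD ((l.length - 1) / 2) 0

/-- Coordinate-wise generalized median on alternative `j`, with phantoms `f k t` and
the voters' reports on alternative `j`. -/
noncomputable def phMed {n m : ℕ} (f : Fin (n + 1) → ℝ → ℝ)
    (P : Fin n → Fin m → ℝ) (t : ℝ) (j : Fin m) : ℝ :=
  medList (List.ofFn (fun k => f k t) ++ List.ofFn (fun i => P i j))

/-- A phantom system for `n` voters: `n+1` continuous, weakly increasing functions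
`[0,1] → [0,1]` with `f k 0 = 0`, `f k 1 = 1`, ordered `f 0 ≥ f 1 ≥ ⋯ ≥ f n`. -/
structure IsPhantomSystem (n : ℕ) (f : Fin (n + 1) → ℝ → ℝ) : Prop where
  cont : ∀ k, ContinuousOn (f k) (Set.Icc 0 1)
  mono : ∀ k, MonotoneOn (f k) (Set.Icc 0 1)
  mem_Icc : ∀ k, ∀ t ∈ Set.Icc (0 : ℝ) 1, f k t ∈ Set.Icc (0 : ℝ) 1
  apply_zero : ∀ k, f k 0 = 0
  apply_one : ∀ k, f k 1 = 1
  ordered : ∀ t ∈ Set.Icc (0 : ℝ) 1, ∀ k l : Fin (n + 1), k ≤ l → f l t ≤ f k t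

/-- The normalizing time `t*` at which the coordinate-wise medians sum to `1`. -/
noncomputable def tStar {n m : ℕ} (f : Fin (n + 1) → ℝ → ℝ)
    (P : Fin n → Fin m → ℝ) : ℝ :=
  sInf {t | t ∈ Set.Icc (0 : ℝ) 1 ∧ ∑ j, phMed f P t j = 1}

/-- The moving phantom mechanism `A^F` defined by the phantom family `f`. -/
noncomputable def AMP {n m : ℕ} (f : Fin (n + 1) → ℝ → ℝ)
    (P : Fin n → Fin m → ℝ) : Fin m → ℝ :=
  fun j => phMed f P (tStar f P) j

/-- The independent-markets phantom system for `n` voters: `f k t = min (t(n-k)) 1`. -/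
noncomputable def fIM (n : ℕ) : Fin (n + 1) → ℝ → ℝ :=
  fun k t => min (t * ((n : ℝ) - (k : ℝ))) 1

/-- The phantom system `F*` for `n` voters, in which the phantoms move to 1 one at a time. -/
noncomputable def fStar (n : ℕ) : Fin (n + 1) → ℝ → ℝ :=
  fun k t => max 0 (min 1 (t * ((n : ℝ) + 1) - (k : ℝ)))

/-- The `j`-th standard unit vector in `ℝ^m`. -/
def unitVec (m : ℕ) (j : Fin m) : Fin m → ℝ := fun k => if k = j then 1 else 0

/-- Incentive compatibility under ℓ1 preferences. -/
def IncentiveCompatible {n m : ℕ} (A : (Fin n → Fin m → ℝ) → (Fin m → ℝ)) : Prop :=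
  ∀ P : Fin n → Fin m → ℝ, IsProfile P → ∀ i : Fin n,
    ∀ ptrue pmis : Fin m → ℝ, IsDivision ptrue → IsDivision pmis →
      l1 (A (Function.update P i ptrue)) ptrue ≤ l1 (A (Function.update P i pmis)) ptrue

/-- Anonymity: the output is invariant under permutations of the voters. -/
def Anonymous {n m : ℕ} (A : (Fin n → Fin m → ℝ) → (Fin m → ℝ)) : Prop :=
  ∀ P : Fin n → Fin m → ℝ, IsProfile P → ∀ σ : Equiv.Perm (Fin n), A (P ∘ σ) = A P

/-- Neutrality: permuting the alternatives in all reports permutes the output likewise. -/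
def Neutral {n m : ℕ} (A : (Fin n → Fin m → ℝ) → (Fin m → ℝ)) : Prop :=
  ∀ P : Fin n → Fin m → ℝ, IsProfile P → ∀ σ : Equiv.Perm (Fin m),
    A (fun i j => P i (σ j)) = fun j => A P (σ j)

/-- Proportionality: on single-minded profiles, alternative `j` gets `n_j / n`. -/
def Proportional {n m : ℕ} (A : (Fin n → Fin m → ℝ) → (Fin m → ℝ)) : Prop :=
  ∀ P : Fin n → Fin m → ℝ, (∀ i, ∃ j, P i = unitVec m j) →
    ∀ j, A P j = (Nat.card {i : Fin n // P i = unitVec m j} : ℝ) / (n : ℝ)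

/-- Pareto optimality. -/
def ParetoOptimal {n m : ℕ} (A : (Fin n → Fin m → ℝ) → (Fin m → ℝ)) : Prop :=
  ∀ P : Fin n → Fin m → ℝ, IsProfile P → ∀ q : Fin m → ℝ, IsDivision q →
    (∃ i, l1 q (P i) < l1 (A P) (P i)) → ∃ i, l1 (A P) (P i) < l1 q (P i)

/-- A mechanism is valid if it maps profiles to budget divisions. -/
def ValidMech {n m : ℕ} (A : (Fin n → Fin m → ℝ) → (Fin m → ℝ)) : Prop :=
  ∀ P, IsProfile P → IsDivision (A P)

/-- `q` maximizes (utilitarian) social welfare for `P`, i.e. minimizes total ℓ1 distance. -/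
def MaximizesWelfare {n m : ℕ} (P : Fin n → Fin m → ℝ) (q : Fin m → ℝ) : Prop :=
  IsDivision q ∧ ∀ q' : Fin m → ℝ, IsDivision q' → ∑ i, l1 (P i) q ≤ ∑ i, l1 (P i) q'

/-- The `k`-th largest entry of `v` (1-indexed); `0` when `k > n`. -/
noncomputable def kthLargest {n : ℕ} (v : Fin n → ℝ) (k : ℕ) : ℝ :=
  (((Multiset.ofList (List.ofFn v)).sort (· ≤ ·)).reverse).getD (k - 1) 0


lemma countP_ofFn_card {N : ℕ} (f : Fin N → ℝ) (p : ℝ → Prop) [DecidablePred p] :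
    (List.ofFn f).countP (fun x => decide (p x)) = (univ.filter (fun i => p (f i))).card := by
  have h := Multiset.countP_map f (univ : Finset (Fin N)).val p
  rw [Fin.univ_val_map] at h
  exact h

lemma med_counts (l : List ℝ) (n : ℕ) (hl : l.length = 2 * n + 1) :
    n + 1 ≤ l.countP (fun x => decide (x ≤ medList l)) ∧
    n + 1 ≤ l.countP (fun x => decide (medList l ≤ x)) := by
  set s := (Multiset.ofList l).sort (· ≤ ·) with hs
  have hperm : s.Perm l := by
    rw [← Multiset.coe_eq_coe, hs, Multiset.sort_eq]
  have hlen : s.length = 2 * n + 1 := by rw [hperm.length_eq, hl]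
  have hsorted : s.Pairwise (· ≤ ·) := Multiset.pairwise_sort _ _
  have hmed : medList l = s[n]'(by omega) := by
    unfold medList
    rw [← hs, hl]
    have : (2 * n + 1 - 1) / 2 = n := by omega
    rw [this, List.getD_eq_getElem]
  have hle : ∀ (i j : ℕ) (hi : i < s.length) (hj : j < s.length), i ≤ j → s[i] ≤ s[j] := by
    intro i j hi hj hij
    rcases hij.eq_or_lt with h | h
    · subst h; exact le_rfl
    · exact List.pairwise_iff_getElem.1 hsorted i j hi hj h
  rw [← hperm.countP_eq, ← hperm.countP_eq]
  constructor
  · have h1 : (s.take (n+1)).countP (fun x => decide (x ≤ medList l)) = (s.take (n+1)).length := by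
      rw [List.countP_eq_length]
      intro a ha
      obtain ⟨i, hi, rfl⟩ := List.mem_iff_getElem.1 ha
      simp only [List.getElem_take, decide_eq_true_eq, hmed]
      apply hle
      simp at hi
      omega
    have h2 := (List.take_sublist (n+1) s).countP_le (p := fun x => decide (x ≤ medList l))
    rw [h1, List.length_take] at h2
    omega
  · have h1 : (s.drop n).countP (fun x => decide (medList l ≤ x)) = (s.drop n).length := by
      rw [List.countP_eq_length]
      intro a ha
      obtain ⟨i, hi, rfl⟩ := List.mem_iff_getElem.1 ha
      simp only [List.getElem_drop, decide_eq_true_eq, hmed]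
      apply hle
      omega
    have h2 := (List.drop_sublist n s).countP_le (p := fun x => decide (medList l ≤ x))
    rw [h1, List.length_drop] at h2
    omega

section
variable {n m : ℕ} (f : Fin (n + 1) → ℝ → ℝ) (P : Fin n → Fin m → ℝ) (t : ℝ) (j : Fin m)

lemma phMed_le_count :
    n + 1 ≤ (univ.filter (fun k => f k t ≤ phMed f P t j)).card
      + (univ.filter (fun i => P i j ≤ phMed f P t j)).card := by
  have h := (med_counts (List.ofFn (fun k => f k t) ++ List.ofFn (fun i => P i j)) n
    (by simp; omega)).1
  rw [List.countP_append, countP_ofFn_card, countP_ofFn_card] at h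
  exact h

lemma phMed_ge_count :
    n + 1 ≤ (univ.filter (fun k => phMed f P t j ≤ f k t)).card
      + (univ.filter (fun i => phMed f P t j ≤ P i j)).card := by
  have h := (med_counts (List.ofFn (fun k => f k t) ++ List.ofFn (fun i => P i j)) n
    (by simp; omega)).2
  rw [List.countP_append, countP_ofFn_card, countP_ofFn_card] at h
  exact h

lemma card_add_le {N : ℕ} (g : Fin N → ℝ) {a b : ℝ} (h : a < b) :
    (univ.filter (fun k => g k ≤ a)).card + (univ.filter (fun k => b ≤ g k)).card ≤ N := by
  rw [← card_union_of_disjoint]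
  · exact (card_le_univ _).trans (by simp)
  · rw [disjoint_filter]
    intro x _ h1 h2
    linarith

lemma le_phMed {c : ℝ} (h : n + 1 ≤ (univ.filter (fun k => c ≤ f k t)).card
      + (univ.filter (fun i => c ≤ P i j)).card) : c ≤ phMed f P t j := by
  by_contra! hc
  have h1 := phMed_le_count f P t j
  have h2 := card_add_le (fun k => f k t) hc
  have h3 := card_add_le (fun i => P i j) hc
  omega

lemma phMed_le {c : ℝ} (h : n + 1 ≤ (univ.filter (fun k => f k t ≤ c)).card
      + (univ.filter (fun i => P i j ≤ c)).card) : phMed f P t j ≤ c := by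
  by_contra! hc
  have h1 := phMed_ge_count f P t j
  have h2 := card_add_le (fun k => f k t) hc
  have h3 := card_add_le (fun i => P i j) hc
  omega

lemma le_phMed_of_all {c : ℝ} (h : ∀ k, c ≤ f k t) : c ≤ phMed f P t j := by
  apply le_phMed
  rw [filter_true_of_mem (fun k _ => h k)]
  simp

lemma phMed_le_of_all {c : ℝ} (h : ∀ k, f k t ≤ c) : phMed f P t j ≤ c := by
  apply phMed_le
  rw [filter_true_of_mem (fun k _ => h k)]
  simp

lemma phMed_lip {s e : ℝ} (he : 0 ≤ e) (h : ∀ k, f k s - e ≤ f k t) :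
    phMed f P s j - e ≤ phMed f P t j := by
  apply le_phMed
  refine (phMed_ge_count f P s j).trans (Nat.add_le_add ?_ ?_)
  · apply card_le_card
    apply monotone_filter_right
    intro k _ hk
    have := h k
    linarith
  · apply card_le_card
    apply monotone_filter_right
    intro k _ hk
    linarith
end

lemma fStar_lip (n : ℕ) (k : Fin (n+1)) (s t : ℝ) :
    fStar n k s - (n + 1) * |s - t| ≤ fStar n k t := by
  unfold fStar
  have h1 : s * ((n:ℝ) + 1) - k ≤ t * ((n:ℝ)+1) - k + (n + 1) * |s - t| := by
    have := le_abs_self (s - t)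
    have hn : (0:ℝ) ≤ n + 1 := by positivity
    nlinarith
  have h2 : 0 ≤ ((n:ℝ) + 1) * |s - t| := by positivity
  generalize ((n:ℝ) + 1) * |s - t| = e at *
  generalize s * ((n:ℝ) + 1) - k = a at *
  generalize t * ((n:ℝ) + 1) - k = b at *
  rw [sub_le_iff_le_add]
  apply max_le
  · have := le_max_left 0 (min 1 b)
    linarith
  · rcases le_total 1 b with h | h
    · have := le_max_right 0 (min 1 b)
      have h3 := min_le_left 1 a
      rw [min_eq_left h] at this ⊢
      linarith
    · have := le_max_right 0 (min 1 b)
      have h3 := min_le_right 1 a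
      rw [min_eq_right h] at this ⊢
      linarith

lemma phMed_fStar_cont {n m : ℕ} (P : Fin n → Fin m → ℝ) (j : Fin m) :
    Continuous (fun t => phMed (fStar n) P t j) := by
  have : LipschitzWith ((n:NNReal) + 1) (fun t => phMed (fStar n) P t j) := by
    apply LipschitzWith.of_le_add_mul
    intro x y
    have := phMed_lip (fStar n) P y j (s := x) (e := (n+1) * |x - y|) (by positivity)
      (fun k => fStar_lip n k x y)
    rw [Real.dist_eq]
    push_cast
    linarith
  exact this.continuous

lemma fStar_mem (n : ℕ) (k : Fin (n+1)) (t : ℝ) : 0 ≤ fStar n k t ∧ fStar n k t ≤ 1 := by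
  unfold fStar
  exact ⟨le_max_left _ _, max_le zero_le_one (min_le_left _ _)⟩

lemma tStar_spec {n m : ℕ} (hm : 2 ≤ m) (P : Fin n → Fin m → ℝ) :
    tStar (fStar n) P ∈ Set.Icc (0:ℝ) 1 ∧ ∑ j, phMed (fStar n) P (tStar (fStar n) P) j = 1 := by
  have hc : Continuous (fun t => ∑ j, phMed (fStar n) P t j) :=
    continuous_finsetSum _ (fun j _ => phMed_fStar_cont P j)
  have hclosed : IsClosed {t | t ∈ Set.Icc (0 : ℝ) 1 ∧ ∑ j, phMed (fStar n) P t j = 1} :=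
    isClosed_Icc.inter (isClosed_eq hc continuous_const)
  have hne : {t | t ∈ Set.Icc (0 : ℝ) 1 ∧ ∑ j, phMed (fStar n) P t j = 1}.Nonempty := by
    have h0 : ∑ j, phMed (fStar n) P 0 j ≤ 1 := by
      have : ∑ j, phMed (fStar n) P 0 j ≤ ∑ j : Fin m, (0:ℝ) := by
        apply sum_le_sum
        intro j _
        apply phMed_le_of_all
        intro k
        unfold fStar
        apply max_le le_rfl
        apply (min_le_right _ _).trans
        have : (0:ℝ) ≤ (k:ℕ) := by positivity
        linarith
      rw [sum_const_zero] at this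
      linarith
    have h1 : 1 ≤ ∑ j, phMed (fStar n) P 1 j := by
      have : ∑ j : Fin m, (1:ℝ) ≤ ∑ j, phMed (fStar n) P 1 j := by
        apply sum_le_sum
        intro j _
        apply le_phMed_of_all
        intro k
        unfold fStar
        apply le_trans _ (le_max_right _ _)
        apply le_min le_rfl
        have : ((k:ℕ):ℝ) ≤ n := by exact_mod_cast (Nat.lt_succ_iff.1 k.2)
        linarith
      have h2 : (2:ℝ) ≤ m := by exact_mod_cast hm
      simp at this
      linarith
    obtain ⟨t, ht, h⟩ := intermediate_value_Icc (zero_le_one (α := ℝ)) hc.continuousOn ⟨h0, h1⟩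
    exact ⟨t, ht, h⟩
  exact hclosed.csInf_mem hne ⟨0, fun t ht => ht.1.1⟩

lemma fStar_split (n : ℕ) (t : ℝ) (ht : t ∈ Set.Icc (0:ℝ) 1) :
    ∃ K : ℕ, K ≤ n ∧ (∀ k : Fin (n+1), (k:ℕ) < K → fStar n k t = 1) ∧
      (∀ k : Fin (n+1), K < (k:ℕ) → fStar n k t = 0) := by
  have h0 : 0 ≤ t * ((n:ℝ)+1) := mul_nonneg ht.1 (by positivity)
  refine ⟨min n ⌊t * ((n:ℝ)+1)⌋₊, min_le_left _ _, ?_, ?_⟩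
  · intro k hk
    have h1 : (k:ℕ) + 1 ≤ ⌊t * ((n:ℝ)+1)⌋₊ := lt_of_lt_of_le hk (min_le_right _ _)
    have h2 : (((k:ℕ) + 1 : ℕ):ℝ) ≤ t * ((n:ℝ)+1) := (Nat.le_floor_iff h0).1 h1
    push_cast at h2
    unfold fStar
    rw [min_eq_left (by linarith), max_eq_right zero_le_one]
  · intro k hk
    have h1 : ⌊t * ((n:ℝ)+1)⌋₊ < (k:ℕ) := by
      have := k.2
      rcases min_lt_iff.1 hk with h | h
      · omega
      · exact h
    have h2 := (Nat.floor_lt h0).1 h1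
    unfold fStar
    rw [max_eq_left]
    exact (min_le_right _ _).trans (by linarith)

lemma sum_abs_right {n : ℕ} (v : Fin n → ℝ) {x q : ℝ} (hq : x ≤ q) (K : ℕ)
    (hK : K ≤ (univ.filter (fun i => v i ≤ x)).card) :
    ∑ i, |v i - x| + (2 * (K:ℝ) - n) * (q - x) ≤ ∑ i, |v i - q| := by
  have h : ∑ i, (|v i - x| + (2 * (if v i ≤ x then (1:ℝ) else 0) - 1) * (q - x))
      ≤ ∑ i, |v i - q| := by
    apply sum_le_sum
    intro i _
    split_ifs with hi
    · rw [abs_of_nonpos (by linarith), abs_of_nonpos (by linarith)]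
      linarith
    · rw [abs_of_nonneg (by linarith)]
      have := le_abs_self (v i - q)
      linarith
  rw [sum_add_distrib, ← sum_mul, sum_sub_distrib, ← mul_sum, sum_boole] at h
  simp only [sum_const, card_univ, Fintype.card_fin, nsmul_eq_mul, mul_one] at h
  have hK' : (K:ℝ) ≤ (univ.filter (fun i => v i ≤ x)).card := by exact_mod_cast hK
  nlinarith

lemma sum_abs_left {n : ℕ} (v : Fin n → ℝ) {x q : ℝ} (hq : q ≤ x) (K : ℕ)
    (hK : n ≤ K + (univ.filter (fun i => x ≤ v i)).card) :
    ∑ i, |v i - x| + (2 * (K:ℝ) - n) * (q - x) ≤ ∑ i, |v i - q| := by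
  have h : ∑ i, (|v i - x| + (2 * (if x ≤ v i then (1:ℝ) else 0) - 1) * (x - q))
      ≤ ∑ i, |v i - q| := by
    apply sum_le_sum
    intro i _
    split_ifs with hi
    · rw [abs_of_nonneg (by linarith), abs_of_nonneg (by linarith)]
      linarith
    · rw [abs_of_nonpos (by linarith)]
      have := neg_le_abs (v i - q)
      linarith
  rw [sum_add_distrib, ← sum_mul, sum_sub_distrib, ← mul_sum, sum_boole] at h
  simp only [sum_const, card_univ, Fintype.card_fin, nsmul_eq_mul, mul_one] at h
  have hK' : (n:ℝ) ≤ K + (univ.filter (fun i => x ≤ v i)).card := by exact_mod_cast hK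
  nlinarith

lemma fstar_coord {n m : ℕ} (P : Fin n → Fin m → ℝ) (t : ℝ) (K : ℕ) (hK : K ≤ n)
    (h1 : ∀ k : Fin (n+1), (k:ℕ) < K → fStar n k t = 1)
    (h0 : ∀ k : Fin (n+1), K < (k:ℕ) → fStar n k t = 0) (j : Fin m) (q : ℝ)
    (hq : q ∈ Set.Icc (0:ℝ) 1) :
    ∑ i, |P i j - phMed (fStar n) P t j| + (2 * (K:ℝ) - n) * (q - phMed (fStar n) P t j)
      ≤ ∑ i, |P i j - q| := by
  set x := phMed (fStar n) P t j with hx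
  rcases lt_trichotomy q x with h | h | h
  · apply sum_abs_left _ h.le
    have hc := phMed_ge_count (fStar n) P t j
    rw [← hx] at hc
    have : (univ.filter (fun k => x ≤ fStar n k t)).card ≤ K + 1 := by
      have hsub : univ.filter (fun k => x ≤ fStar n k t) ⊆ univ.filter (fun k => (k:ℕ) < K + 1) := by
        apply monotone_filter_right
        intro k _ hk
        by_contra hk'
        have := h0 k (by omega)
        have := hq.1
        linarith
      refine (card_le_card hsub).trans ?_
      rw [← card_map Fin.valEmbedding]
      refine (card_le_card (t := range (K+1)) ?_).trans (by simp)
      intro a ha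
      simp at ha
      simp
      omega
    omega
  · rw [h]; simp
  · apply sum_abs_right _ h.le
    have hc := phMed_le_count (fStar n) P t j
    rw [← hx] at hc
    have : (univ.filter (fun k => fStar n k t ≤ x)).card ≤ n + 1 - K := by
      have hsub : univ.filter (fun k => fStar n k t ≤ x) ⊆ univ.filter (fun k => K ≤ (k:ℕ)) := by
        apply monotone_filter_right
        intro k _ hk
        by_contra hk'
        have := h1 k (by omega)
        have := hq.2
        linarith
      refine (card_le_card hsub).trans ?_
      rw [← card_map Fin.valEmbedding]
      refine (card_le_card (t := Finset.Ico K (n+1)) ?_).trans (by simp)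
      intro a ha
      simp at ha
      simp
      omega
    omega

lemma fstar_welfare {n m : ℕ} (hm : 2 ≤ m) (P : Fin n → Fin m → ℝ) :
    MaximizesWelfare P (AMP (fStar n) P) := by
  obtain ⟨ht, hsum⟩ := tStar_spec hm P
  refine ⟨⟨fun j => ⟨le_phMed_of_all _ _ _ _ fun k => (fStar_mem n k _).1,
    phMed_le_of_all _ _ _ _ fun k => (fStar_mem n k _).2⟩, hsum⟩, ?_⟩
  intro q hq
  obtain ⟨K, hK, h1, h0⟩ := fStar_split n _ ht
  unfold l1 AMP
  rw [sum_comm, sum_comm (f := fun i j => |P i j - q j|)]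
  have h := sum_le_sum (s := univ) fun j _ => fstar_coord P _ K hK h1 h0 j (q j) (hq.1 j)
  rw [sum_add_distrib, ← mul_sum, sum_sub_distrib, hsum, hq.2] at h
  linarith

/-- `A^{F*}` maximizes social welfare on every profile, and consequently
 it is Pareto-optimal. -/
theorem fstar_welfare_and_pareto (n m : ℕ) (hn : 1 ≤ n) (hm : 2 ≤ m) :
    (∀ P : Fin n → Fin m → ℝ, IsProfile P → MaximizesWelfare P (AMP (fStar n) P)) ∧
    ParetoOptimal (fun P : Fin n → Fin m → ℝ => AMP (fStar n) P) := by
  refine ⟨fun P _ => fstar_welfare hm P, ?_⟩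
  intro P _ q hq
  rintro ⟨i, hi⟩
  by_contra! hcon
  have h := (fstar_welfare hm P).2 q hq
  have hc : ∀ x y : Fin m → ℝ, l1 x y = l1 y x := fun x y => by
    unfold l1
    exact sum_congr rfl fun j _ => abs_sub_comm _ _
  have h2 : ∑ i, l1 q (P i) < ∑ i, l1 (AMP (fStar n) P) (P i) :=
    sum_lt_sum (fun i _ => hcon i) ⟨i, mem_univ _, hi⟩
  simp only [hc (P _)] at h
  linarith
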